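/- Assume 2 < d < r + 3, r | k, r < k, and n = k + k/r + d − 2. Then there is no linear [n,k,d]_q code in which every coordinate i ∈ [n] satisfies loc(c_i) ≤ r. -/

import Mathlib

open Matrix Finset

/-- The Hamming weight of the codeword encoding `x` under the code with points `c`. -/
def codewordWeight {n k : ℕ} {F : Type} [Field F] [DecidableEq F]
    (c : Fin n → Fin k → F) (x : Fin k → F) : ℕ :=
  (Finset.univ.filter fun i : Fin n => c i ⬝ᵥ x ≠ 0).card

/-- The code determined by the points `c` has minimum distance `d`. -/
def HasDistance {n k : ℕ} {F : Type} [Field F] [DecidableEq F]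
    (c : Fin n → Fin k → F) (d : ℕ) : Prop :=
  (∀ x : Fin k → F, x ≠ 0 → d ≤ codewordWeight c x) ∧
  (∃ x : Fin k → F, x ≠ 0 ∧ codewordWeight c x = d)

/-- `loc(c_i) ≤ r`: the point `c i` is a linear combination of at most `r` other points. -/
def LocLE {n k : ℕ} {F : Type} [Field F]
    (c : Fin n → Fin k → F) (i : Fin n) (r : ℕ) : Prop :=
  ∃ R : Finset (Fin n), i ∉ R ∧ R.card ≤ r ∧
    ∃ lam : Fin n → F, c i = ∑ j ∈ R, lam j • c j

/-- The dimension of the span of the points indexed by `S`. -/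
noncomputable def pointRank {ι F V : Type*} [Field F] [AddCommGroup V] [Module F V]
    (c : ι → V) (S : Finset ι) : ℕ :=
  Module.finrank F (Submodule.span F (c '' (S : Set ι)))

section PointRank

variable {ι F V : Type*} [DecidableEq ι] [Field F] [AddCommGroup V] [Module F V]
  [FiniteDimensional F V]

theorem pointRank_union_le_add_card (c : ι → V) (S T : Finset ι) :
    pointRank (F := F) c (S ∪ T) ≤ pointRank (F := F) c S + T.card := by
  classical
  unfold pointRank
  rw [Finset.coe_union, Set.image_union, Submodule.span_union]
  refine (Submodule.finrank_add_le_finrank_add_finrank _ _).trans ?_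
  gcongr
  rw [← Finset.coe_image]
  exact (finrank_span_finset_le_card _).trans Finset.card_image_le

/-- Adjoining a set `G` containing a point dependent on the others costs at most the number of
those others that are not already present. -/
theorem pointRank_union_le_of_mem_span (c : ι → V) {S G T : Finset ι} {i : ι}
    (hi : c i ∈ Submodule.span F (c '' (G.erase i : Set ι))) (hT : G.erase i ⊆ S ∪ T) :
    pointRank (F := F) c (S ∪ G) ≤ pointRank (F := F) c S + T.card := by
  refine le_trans ?_ (pointRank_union_le_add_card c S T)
  refine Submodule.finrank_mono (Submodule.span_le.2 ?_)
  rintro _ ⟨j, hj, rfl⟩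
  by_cases hji : j = i
  · subst hji
    exact Submodule.span_mono (Set.image_mono (Finset.coe_subset.2 hT)) hi
  · refine Submodule.subset_span ⟨j, ?_, rfl⟩
    rcases Finset.mem_union.1 (Finset.mem_coe.1 hj) with h | h
    · exact Finset.mem_coe.2 (Finset.mem_union_left _ h)
    · exact Finset.mem_coe.2 (hT (Finset.mem_erase.2 ⟨hji, h⟩))

theorem pointRank_insert_of_notMem_span (c : ι → V) {S : Finset ι} {i : ι}
    (hi : c i ∉ Submodule.span F (c '' (S : Set ι))) :
    pointRank (F := F) c S < pointRank (F := F) c (insert i S) := by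
  refine Submodule.finrank_lt_finrank_of_lt (lt_of_le_of_ne ?_ ?_)
  · exact Submodule.span_mono (Set.image_mono (by simp))
  · intro h
    exact hi (h ▸ Submodule.subset_span ⟨i, by simp, rfl⟩)

theorem pointRank_insert_le (c : ι → V) (S : Finset ι) (i : ι) :
    pointRank (F := F) c (insert i S) ≤ pointRank (F := F) c S + 1 := by
  rw [Finset.insert_eq, Finset.union_comm]
  exact pointRank_union_le_add_card c S {i}

end PointRank

theorem exists_notMem_span_of_pointRank_lt {F : Type*} [Field F] {n k : ℕ}
    {c : Fin n → Fin k → F}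
    (hspan : Submodule.span F (Set.range c) = ⊤) {S : Finset (Fin n)}
    (hS : pointRank (F := F) c S < k) :
    ∃ i, c i ∉ Submodule.span F (c '' (S : Set (Fin n))) := by
  by_contra! h
  have htop : Submodule.span F (c '' (S : Set (Fin n))) = ⊤ := by
    rw [eq_top_iff, ← hspan, Submodule.span_le]
    rintro _ ⟨i, rfl⟩
    exact h i
  rw [pointRank, htop, finrank_top, Module.finrank_fin_fun] at hS
  exact hS.false

section Distance

variable {F : Type} [Field F] [DecidableEq F] {n k d : ℕ} {c : Fin n → Fin k → F}

theorem card_add_le_of_pointRank_lt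
    (hdist : ∀ x : Fin k → F, x ≠ 0 → d ≤ codewordWeight c x) {S : Finset (Fin n)}
    (hS : pointRank (F := F) c S < k) : S.card + d ≤ n := by
  have hlt : Submodule.span F (c '' (S : Set (Fin n))) < ⊤ := by
    refine lt_top_iff_ne_top.2 fun h => ?_
    rw [pointRank, h, finrank_top, Module.finrank_fin_fun] at hS
    exact hS.false
  obtain ⟨f, hf, hle⟩ := Submodule.exists_le_ker_of_lt_top _ hlt
  have hdot (v : Fin k → F) : v ⬝ᵥ (fun j => f (Pi.single j 1)) = f v := by
    rw [LinearMap.pi_apply_eq_sum_univ f v]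
    simp only [dotProduct, smul_eq_mul]
    refine Finset.sum_congr rfl fun j _ => ?_
    congr 2
    ext l
    simp [Pi.single_apply, eq_comm]
  have hx : (fun j => f (Pi.single j 1)) ≠ 0 := by
    intro h
    refine hf (LinearMap.ext fun v => ?_)
    rw [← hdot v, h]
    simp
  have hw := hdist _ hx
  have hsub : (Finset.univ.filter fun i => c i ⬝ᵥ (fun j => f (Pi.single j 1)) ≠ 0) ⊆ Sᶜ := by
    intro i hi
    rw [Finset.mem_filter] at hi
    rw [Finset.mem_compl]
    intro hiS
    exact hi.2 ((hdot _).trans (hle (Submodule.subset_span ⟨i, hiS, rfl⟩)))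
  have hcard := Finset.card_le_card hsub
  rw [Finset.card_compl, Fintype.card_fin] at hcard
  have hSn : S.card ≤ n := by simpa using Finset.card_le_univ S
  unfold codewordWeight at hw
  omega

/-- A set of points not spanning the whole space has nullity at most `n - d - (k - 1)`. -/
theorem card_add_le_pointRank_add
    (hspan : Submodule.span F (Set.range c) = ⊤)
    (hdist : ∀ x : Fin k → F, x ≠ 0 → d ≤ codewordWeight c x) {S : Finset (Fin n)}
    (hS : pointRank (F := F) c S < k) :
    S.card + d + k ≤ n + pointRank (F := F) c S + 1 := by
  induction hm : k - pointRank (F := F) c S generalizing S with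
  | zero => omega
  | succ m ih =>
    by_cases hlast : pointRank (F := F) c S + 1 = k
    · have := card_add_le_of_pointRank_lt hdist hS
      omega
    obtain ⟨i, hi⟩ := exists_notMem_span_of_pointRank_lt hspan hS
    have hlt := pointRank_insert_of_notMem_span c hi
    have hle := pointRank_insert_le (F := F) c S i
    have hiS : i ∉ S := fun h => hi (Submodule.subset_span ⟨i, h, rfl⟩)
    have := ih (S := insert i S) (by omega) (by omega)
    rw [Finset.card_insert_of_notMem hiS] at this
    omega

end Distance

theorem LocLE.exists_repairGroup {n k r : ℕ} {F : Type} [Field F] {c : Fin n → Fin k → F}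
    {i : Fin n} (h : LocLE c i r) :
    ∃ G : Finset (Fin n), i ∈ G ∧ G.card ≤ r + 1 ∧
      c i ∈ Submodule.span F (c '' (G.erase i : Set (Fin n))) := by
  obtain ⟨R, hiR, hcard, lam, hsum⟩ := h
  refine ⟨insert i R, Finset.mem_insert_self _ _, ?_, ?_⟩
  · rw [Finset.card_insert_of_notMem hiR]
    omega
  · rw [Finset.erase_insert hiR, hsum]
    exact Submodule.sum_mem _ fun j hj =>
      Submodule.smul_mem _ _ (Submodule.subset_span ⟨j, hj, rfl⟩)

/-- For 2 < d < r + 3, r ∣ k, r < k and n = k + k/r + d − 2, there is no linear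
    [n,k,d]_q code in which every coordinate has locality at most r. -/
theorem no_code_with_all_locality
    {F : Type} [Field F] [Fintype F] [DecidableEq F]
    {n k d r : ℕ} (hd2 : 2 < d) (hdr : d < r + 3) (hrk : r ∣ k) (hrlt : r < k)
    (hn : n = k + k / r + d - 2)
    (c : Fin n → Fin k → F)
    (hspan : Submodule.span F (Set.range c) = ⊤)
    (hdist : HasDistance c d)
    (hloc : ∀ i : Fin n, LocLE c i r) :
    False := by
  obtain ⟨t, rfl⟩ := hrk
  have hr : 0 < r := by omega
  rw [Nat.mul_div_cancel_left t hr] at hn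
  have ht : 2 ≤ t := by
    by_contra! h
    have : r * t ≤ r * 1 := Nat.mul_le_mul_left r (by omega)
    omega
  choose G hmem hcard hdep using fun i => (hloc i).exists_repairGroup
  have null_le {S : Finset (Fin n)} (hS : pointRank (F := F) c S < r * t) :
      S.card + 1 ≤ pointRank (F := F) c S + t := by
    have := card_add_le_pointRank_add hspan hdist.1 hS
    omega
  have rank_step (S : Finset (Fin n)) (i : Fin n) :
      pointRank (F := F) c (S ∪ G i) ≤ pointRank (F := F) c S + r := by
    have h := pointRank_union_le_of_mem_span c (S := S) (hdep i) Finset.subset_union_right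
    have := hcard i
    rw [Finset.card_erase_of_mem (hmem i)] at h
    omega
  have null_step {S : Finset (Fin n)} {i : Fin n} (hi : i ∉ S) :
      pointRank (F := F) c (S ∪ G i) + 1 ≤ pointRank (F := F) c S + (G i \ S).card := by
    have hiG : i ∈ G i \ S := Finset.mem_sdiff.2 ⟨hmem i, hi⟩
    have h := pointRank_union_le_of_mem_span c (S := S) (T := (G i \ S).erase i) (hdep i)
      (by
        intro j hj
        simp only [Finset.mem_erase, Finset.mem_union, Finset.mem_sdiff] at hj ⊢
        tauto)
    rw [Finset.card_erase_of_mem hiG] at h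
    have := Finset.card_pos.2 ⟨i, hiG⟩
    omega
  have card_step (S : Finset (Fin n)) (i : Fin n) :
      (S ∪ G i).card = S.card + (G i \ S).card := by
    rw [← Finset.card_union_of_disjoint Finset.disjoint_sdiff, Finset.union_sdiff_self_eq_union]
  have exists_notMem {S : Finset (Fin n)} (hS : pointRank (F := F) c S < r * t) :
      ∃ i, i ∉ S := by
    obtain ⟨i, hi⟩ := exists_notMem_span_of_pointRank_lt hspan hS
    exact ⟨i, fun h => hi (Submodule.subset_span ⟨i, h, rfl⟩)⟩
  -- A chain of `m` groups has rank exactly `r * m`: a deficit would persist up to `m = t`.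
  have no_deficit (s m : ℕ) (hms : m + s = t) (S : Finset (Fin n))
      (hnull : pointRank (F := F) c S + m ≤ S.card) : r * m ≤ pointRank (F := F) c S := by
    induction s generalizing m S with
    | zero =>
      by_contra! h
      obtain rfl : m = t := hms
      have := null_le h
      omega
    | succ s ih =>
      by_contra! h
      have hmt : r * (m + 1) ≤ r * t := Nat.mul_le_mul_left r (by omega)
      rw [Nat.mul_succ] at hmt
      obtain ⟨i, hi⟩ := exists_notMem (S := S) (by omega)
      have h1 := null_step hi
      have h2 := card_step S i
      have h3 := rank_step S i
      have h4 := ih (m + 1) (by omega) (S ∪ G i) (by omega)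
      rw [Nat.mul_succ] at h4
      omega
  have group_new {m : ℕ} {S : Finset (Fin n)} {i : Fin n} (hm : m < t)
      (hnull : pointRank (F := F) c S + m ≤ S.card) (hrank : pointRank (F := F) c S ≤ r * m)
      (hi : i ∉ S) : (G i).card = r + 1 ∧ Disjoint (G i) S := by
    have h1 := null_step hi
    have h2 := card_step S i
    have h3 := no_deficit (t - (m + 1)) (m + 1) (by omega) (S ∪ G i) (by omega)
    rw [Nat.mul_succ] at h3
    have h4 := hcard i
    have h5 : (G i \ S).card ≤ (G i).card := Finset.card_le_card Finset.sdiff_subset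
    have h6 : G i \ S = G i := Finset.eq_of_subset_of_card_le Finset.sdiff_subset (by omega)
    exact ⟨by omega, Finset.sdiff_eq_self_iff_disjoint.1 h6⟩
  have rank_empty : pointRank (F := F) c ∅ = 0 := by simp [pointRank]
  have group_card (i : Fin n) : (G i).card = r + 1 :=
    (group_new (m := 0) (S := ∅) (by omega) (by simp [rank_empty]) (by simp [rank_empty])
      (by simp)).1
  have group_disjoint {i j : Fin n} (hj : j ∉ G i) : Disjoint (G j) (G i) := by
    have h1 := null_step (Finset.notMem_empty i)
    have h2 := rank_step ∅ i
    rw [Finset.empty_union, rank_empty] at h1 h2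
    rw [Finset.sdiff_empty] at h1
    exact (group_new (m := 1) (by omega) (by omega) (by omega) hj).2
  have chain (m : ℕ) (hm : m ≤ t) : ∃ I : Finset (Fin n),
      (I.biUnion G).card = m * (r + 1) ∧ pointRank (F := F) c (I.biUnion G) ≤ r * m := by
    induction m with
    | zero => exact ⟨∅, by simp, by simp [rank_empty]⟩
    | succ m ih =>
      obtain ⟨I, hI, hrank⟩ := ih (by omega)
      have hmt : r * (m + 1) ≤ r * t := Nat.mul_le_mul_left r hm
      rw [Nat.mul_succ] at hmt
      obtain ⟨i, hi⟩ := exists_notMem (S := I.biUnion G) (by omega)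
      have hnew := (group_new (m := m) (by omega) (by rw [hI]; linarith) hrank hi).2
      refine ⟨insert i I, ?_, ?_⟩
      · rw [Finset.biUnion_insert, Finset.card_union_of_disjoint hnew, group_card, hI]
        ring
      · rw [Finset.biUnion_insert, Finset.union_comm, Nat.mul_succ]
        exact (rank_step _ i).trans (by omega)
  obtain ⟨I, hI, -⟩ := chain t le_rfl
  have hexp : t * (r + 1) = r * t + t := by ring
  obtain ⟨l, hl⟩ : ∃ l, l ∉ I.biUnion G := by
    by_contra! h
    have := Finset.card_fin n
    rw [← Finset.eq_univ_iff_forall.2 h] at this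
    omega
  have hdisj : Disjoint (G l) (I.biUnion G) :=
    (Finset.disjoint_biUnion_right _ _ _).2 fun i hi =>
      group_disjoint fun h => hl (Finset.mem_biUnion.2 ⟨i, hi, h⟩)
  have hle := Finset.card_le_univ (G l ∪ I.biUnion G)
  rw [Finset.card_union_of_disjoint hdisj, group_card, hI, Fintype.card_fin] at hle
  omega
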